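/- For plane trees with edge increments in {0,+1,-1}, setting T = T(t) = (1 - 6t - sqrt(1-12t))/(6t), one has F_2(t, e^{iu}, e^{-iu}) = (1+T)(9 + T^2 (1 + 2 cos u)^2) / ((1-T)(3 - T(1 + 2 cos u))^2). -/

import Mathlib

open Complex

/-- Plane trees whose edges carry increments in `{-1, 0, +1}`, encoded by `Fin 3`
(`e ↦ (e : ℤ) - 1`).  The induced node labelling gives the root label `0`. -/
inductive PTree3 where
  | node : List (Fin 3 × PTree3) → PTree3

mutual
/-- Number of edges. -/
def PTree3.edges : PTree3 → ℕ
  | .node cs => PTree3.edgesList cs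
def PTree3.edgesList : List (Fin 3 × PTree3) → ℕ
  | [] => 0
  | (_, t) :: rest => t.edges + 1 + PTree3.edgesList rest
end

mutual
/-- `∑_{v ∈ T} x^{ℓ(v)}` for the induced labelling (root labelled `0`). -/
noncomputable def PTree3.labelSum : PTree3 → ℂ → ℂ
  | .node cs, x => 1 + PTree3.labelSumList cs x
noncomputable def PTree3.labelSumList : List (Fin 3 × PTree3) → ℂ → ℂ
  | [], _ => 0
  | (e, t) :: rest, x =>
      x ^ ((e : ℤ) - 1) * t.labelSum x + PTree3.labelSumList rest x
end

/-- `T(t) = (1 - 6t - √(1-12t))/(6t)`, the generating function (by edges) of labelled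
plane trees with increments `0, ±1` and at least one edge; it satisfies `T = 3t(1+T)²`. -/
noncomputable def Tfun3 (t : ℝ) : ℝ := (1 - 6*t - Real.sqrt (1 - 12*t)) / (6*t)

namespace PTree3

/-- The tree consisting of the root only. -/
def leaf : PTree3 := .node []

/-- Add to the root of `r` a new leftmost subtree `s`, attached by an edge with increment `e`. -/
def graft (e : Fin 3) (s : PTree3) : PTree3 → PTree3
  | .node cs => .node ((e, s) :: cs)

/-- A tree is either a single root or a leftmost subtree grafted on a smaller tree. -/
def graftEquiv : Unit ⊕ (Fin 3 × PTree3 × PTree3) ≃ PTree3 where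
  toFun
    | .inl _ => leaf
    | .inr (e, s, r) => graft e s r
  invFun
    | .node [] => .inl ()
    | .node ((e, s) :: cs) => .inr (e, s, .node cs)
  left_inv := by rintro (_ | ⟨e, s, ⟨cs⟩⟩) <;> rfl
  right_inv := by rintro ⟨_ | ⟨⟨e, s⟩, cs⟩⟩ <;> rfl

@[simp] lemma graftEquiv_inl (a : Unit) : graftEquiv (.inl a) = leaf := rfl

@[simp] lemma graftEquiv_inr (p : Fin 3 × PTree3 × PTree3) :
    graftEquiv (.inr p) = graft p.1 p.2.1 p.2.2 := rfl

@[simp] lemma edges_leaf : leaf.edges = 0 := by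
  simp [leaf, edges, edgesList]

@[simp] lemma edges_graft (e : Fin 3) (s r : PTree3) :
    (graft e s r).edges = s.edges + 1 + r.edges := by
  cases r; simp [graft, edges, edgesList]

@[simp] lemma labelSum_leaf (x : ℂ) : leaf.labelSum x = 1 := by
  simp [leaf, labelSum, labelSumList]

@[simp] lemma labelSum_graft (e : Fin 3) (s r : PTree3) (x : ℂ) :
    (graft e s r).labelSum x = x ^ ((e : ℤ) - 1) * s.labelSum x + r.labelSum x := by
  cases r; simp [graft, labelSum, labelSumList]; ring

lemma graft_induction {P : PTree3 → Prop} (hleaf : P leaf)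
    (hgraft : ∀ e s r, P s → P r → P (graft e s r)) (T : PTree3) : P T := by
  induction h : T.edges using Nat.strong_induction_on generalizing T with
  | _ n ih =>
    obtain ⟨o, rfl⟩ := graftEquiv.surjective T
    rcases o with _ | ⟨e, s, r⟩
    · exact hleaf
    · simp only [graftEquiv_inr, edges_graft] at h
      exact hgraft e s r (ih _ (by omega) s rfl) (ih _ (by omega) r rfl)

lemma norm_labelSum_le {x : ℂ} (hx : ‖x‖ = 1) (T : PTree3) :
    ‖T.labelSum x‖ ≤ T.edges + 1 := by
  induction T using graft_induction with
  | hleaf => simp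
  | hgraft e s r hs hr =>
    simp only [labelSum_graft, edges_graft]
    refine (norm_add_le _ _).trans ?_
    rw [norm_mul, norm_zpow, hx, one_zpow, one_mul]
    push_cast
    linarith

section ENNReal
open scoped ENNReal

lemma ennreal_tsum_eq (f : PTree3 → ℝ≥0∞) :
    ∑' T, f T = f leaf + ∑ e : Fin 3, ∑' s, ∑' r, f (graft e s r) := by
  rw [← graftEquiv.tsum_eq, ENNReal.summable.tsum_sum ENNReal.summable]
  simp [ENNReal.tsum_prod']

lemma tsum_edges_lt_le_two (c : ℝ≥0∞) (hc : 3 * c * (2 * 2) ≤ 1) (N : ℕ) :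
    ∑' T : PTree3, (if T.edges < N then c ^ T.edges else 0) ≤ 2 := by
  induction N with
  | zero => simp
  | succ N ih =>
    rw [ennreal_tsum_eq]
    set a := ∑' T : PTree3, (if T.edges < N then c ^ T.edges else 0) with ha
    have key : ∀ e : Fin 3, ∑' s, ∑' r, (if (graft e s r).edges < N + 1
        then c ^ (graft e s r).edges else 0) ≤ c * (a * a) := by
      intro e
      have : c * (a * a) = ∑' s : PTree3, ∑' r : PTree3,
          c * ((if s.edges < N then c ^ s.edges else 0) *
            (if r.edges < N then c ^ r.edges else 0)) := by
        simp only [ENNReal.tsum_mul_left, ENNReal.tsum_mul_right, a]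
      rw [this]
      refine ENNReal.tsum_le_tsum fun s => ENNReal.tsum_le_tsum fun r => ?_
      rw [edges_graft]
      split_ifs
      · exact le_of_eq (by ring)
      all_goals first | omega | simp
    calc _ ≤ 1 + ∑ e : Fin 3, c * (a * a) := by
          gcongr with e
          · simp
          · exact key e
      _ = 1 + 3 * c * (a * a) := by simp; ring
      _ ≤ 1 + 3 * c * (2 * 2) := by gcongr
      _ ≤ 1 + 1 := by gcongr
      _ = 2 := one_add_one_eq_two

lemma tsum_pow_edges_le_two (c : ℝ≥0∞) (hc : 3 * c * (2 * 2) ≤ 1) :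
    ∑' T : PTree3, c ^ T.edges ≤ 2 := by
  refine ENNReal.summable.tsum_le_of_sum_le fun s => ?_
  obtain ⟨N, hN⟩ : ∃ N, ∀ T ∈ s, T.edges < N :=
    ⟨s.sup edges + 1, fun T hT => Nat.lt_succ_of_le (Finset.le_sup hT)⟩
  refine le_trans ?_ (tsum_edges_lt_le_two c hc N)
  refine le_trans (Finset.sum_le_sum fun T hT => ?_) (ENNReal.sum_le_tsum s)
  rw [if_pos (hN T hT)]

end ENNReal

lemma tsum_ofReal_pow_edges_le_two {t : ℝ} (ht0 : 0 ≤ t) (ht : t ≤ 1 / 12) :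
    ∑' T : PTree3, ENNReal.ofReal (t ^ T.edges) ≤ 2 := by
  simp only [ENNReal.ofReal_pow ht0]
  apply tsum_pow_edges_le_two
  have : 3 * ENNReal.ofReal t * (2 * 2) = ENNReal.ofReal (3 * t * (2 * 2)) := by
    rw [ENNReal.ofReal_mul (by positivity), ENNReal.ofReal_mul (by norm_num),
      ENNReal.ofReal_mul (by norm_num)]
    simp
  rw [this, ENNReal.ofReal_le_one]
  linarith

lemma summable_pow_edges {t : ℝ} (ht0 : 0 ≤ t) (ht : t ≤ 1 / 12) :
    Summable fun T : PTree3 => t ^ T.edges := by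
  have h := tsum_ofReal_pow_edges_le_two ht0 ht
  have := ENNReal.summable_toReal (h.trans_lt (by simp)).ne
  refine this.congr fun T => ENNReal.toReal_ofReal (by positivity)

lemma tsum_pow_edges_real_le_two {t : ℝ} (ht0 : 0 ≤ t) (ht : t ≤ 1 / 12) :
    ∑' T : PTree3, t ^ T.edges ≤ 2 := by
  have h := tsum_ofReal_pow_edges_le_two ht0 ht
  rw [← ENNReal.ofReal_tsum_of_nonneg (fun T => by positivity) (summable_pow_edges ht0 ht)] at h
  simpa using (ENNReal.ofReal_le_ofReal_iff (q := 2) (by norm_num)).1 (by simpa using h)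

lemma summable_sq_mul_pow_edges {t : ℝ} (ht0 : 0 ≤ t) (ht : t < 1 / 12) :
    Summable fun T : PTree3 => ((T.edges : ℝ) + 1) ^ 2 * t ^ T.edges := by
  have hs : Summable fun n : ℕ => ((n : ℝ) + 1) ^ 2 * (12 * t) ^ n := by
    have hq : ‖12 * t‖ < 1 := by rw [Real.norm_of_nonneg (by linarith)]; linarith
    have h0 := summable_pow_mul_geometric_of_norm_lt_one 0 hq
    have h1 := summable_pow_mul_geometric_of_norm_lt_one 1 hq
    have h2 := summable_pow_mul_geometric_of_norm_lt_one 2 hq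
    refine ((h2.add (h1.mul_left 2)).add h0).congr fun n => ?_
    ring
  have hb : Summable fun T : PTree3 =>
      (∑' n : ℕ, ((n : ℝ) + 1) ^ 2 * (12 * t) ^ n) * (1 / 12 : ℝ) ^ T.edges :=
    (summable_pow_edges (by norm_num) le_rfl).mul_left _
  refine hb.of_nonneg_of_le (fun T => by positivity) fun T => ?_
  have h := hs.le_tsum T.edges fun n _ => by positivity
  calc _ = (((T.edges : ℝ) + 1) ^ 2 * (12 * t) ^ T.edges) * (1 / 12 : ℝ) ^ T.edges := by
        rw [mul_assoc, ← mul_pow]; congr 2; ring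
    _ ≤ _ := by gcongr

lemma tsum_eq_add_sum_graft {f : PTree3 → ℂ} (hf : Summable f) :
    ∑' T, f T = f leaf + ∑ e : Fin 3, ∑' p : PTree3 × PTree3, f (graft e p.1 p.2) := by
  have hs : Summable fun p : Fin 3 × PTree3 × PTree3 => f (graft p.1 p.2.1 p.2.2) :=
    hf.comp_injective (graftEquiv.injective.comp Sum.inr_injective)
  have hr : ∑' p : Fin 3 × PTree3 × PTree3, f (graft p.1 p.2.1 p.2.2) =
      ∑ e : Fin 3, ∑' p : PTree3 × PTree3, f (graft e p.1 p.2) := by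
    rw [hs.tsum_prod, tsum_fintype]
  rw [← hr, ← graftEquiv.tsum_eq, Summable.tsum_sum (hasSum_fintype _).summable hs]
  simp

lemma sum_zpow_sub_one (x : ℂ) (g : ℂ → ℂ) :
    ∑ e : Fin 3, g (x ^ ((e : ℤ) - 1)) = g x⁻¹ + g 1 + g x := by
  simp [Fin.sum_univ_three]

section Series
variable {t : ℝ} {x y : ℂ}

lemma summable_norm_of_le (ht0 : 0 ≤ t) (ht : t < 1 / 12) {g : PTree3 → ℂ}
    (hg : ∀ T, ‖g T‖ ≤ ((T.edges : ℝ) + 1) ^ 2) :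
    Summable fun T : PTree3 => ‖(t : ℂ) ^ T.edges * g T‖ := by
  refine (summable_sq_mul_pow_edges ht0 ht).of_nonneg_of_le (fun _ => norm_nonneg _) fun T => ?_
  rw [norm_mul, norm_pow, Complex.norm_of_nonneg ht0, mul_comm]
  exact mul_le_mul_of_nonneg_right (hg T) (by positivity)

lemma summable_norm_pow (ht0 : 0 ≤ t) (ht : t < 1 / 12) :
    Summable fun T : PTree3 => ‖(t : ℂ) ^ T.edges‖ := by
  simpa using summable_norm_of_le ht0 ht (g := fun _ => 1) fun T => by
    rw [norm_one]; exact one_le_pow₀ (by linarith [T.edges.cast_nonneg (α := ℝ)])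

lemma summable_norm_labelSum (ht0 : 0 ≤ t) (ht : t < 1 / 12) (hx : ‖x‖ = 1) :
    Summable fun T : PTree3 => ‖(t : ℂ) ^ T.edges * T.labelSum x‖ :=
  summable_norm_of_le ht0 ht fun T => (norm_labelSum_le hx T).trans
    (le_self_pow₀ (by linarith [T.edges.cast_nonneg (α := ℝ)]) two_ne_zero)

lemma summable_norm_labelSum_mul (ht0 : 0 ≤ t) (ht : t < 1 / 12) (hx : ‖x‖ = 1) (hy : ‖y‖ = 1) :
    Summable fun T : PTree3 => ‖(t : ℂ) ^ T.edges * T.labelSum x * T.labelSum y‖ := by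
  simp only [mul_assoc]
  refine summable_norm_of_le ht0 ht fun T => ?_
  rw [norm_mul, sq]
  exact mul_le_mul (norm_labelSum_le hx T) (norm_labelSum_le hy T) (norm_nonneg _) (by positivity)

lemma hasSum_mul_of_summable_norm {f g : PTree3 → ℂ} (hf : Summable fun T => ‖f T‖)
    (hg : Summable fun T => ‖g T‖) :
    HasSum (fun p : PTree3 × PTree3 => f p.1 * g p.2) ((∑' T, f T) * ∑' T, g T) := by
  rw [tsum_mul_tsum_of_summable_norm hf hg]
  exact (summable_mul_of_summable_norm hf hg).hasSum

/-- The series counting trees by edges. -/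
lemma tsum_pow_edges_eq (ht0 : 0 ≤ t) (ht : t < 1 / 12) :
    ∑' T : PTree3, (t : ℂ) ^ T.edges = 1 + 3 * t * (∑' T : PTree3, (t : ℂ) ^ T.edges) ^ 2 := by
  have h := summable_norm_pow ht0 ht
  set A := ∑' T : PTree3, (t : ℂ) ^ T.edges
  have hgraft (e : Fin 3) :
      ∑' p : PTree3 × PTree3, (t : ℂ) ^ (graft e p.1 p.2).edges = t * (A * A) := by
    rw [← ((hasSum_mul_of_summable_norm h h).mul_left (t : ℂ)).tsum_eq]
    refine tsum_congr fun p => ?_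
    rw [edges_graft]
    ring
  refine (tsum_eq_add_sum_graft h.of_norm).trans ?_
  rw [Finset.sum_congr rfl fun e _ => hgraft e]
  simp
  ring

/-- The one-point series `F₁`. -/
lemma tsum_labelSum_eq (ht0 : 0 ≤ t) (ht : t < 1 / 12) (hx : ‖x‖ = 1) :
    ∑' T : PTree3, (t : ℂ) ^ T.edges * T.labelSum x =
      1 + t * (3 + (x⁻¹ + 1 + x)) * (∑' T : PTree3, (t : ℂ) ^ T.edges) *
        ∑' T : PTree3, (t : ℂ) ^ T.edges * T.labelSum x := by
  have h := summable_norm_pow ht0 ht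
  have h1 := summable_norm_labelSum ht0 ht hx
  set A := ∑' T : PTree3, (t : ℂ) ^ T.edges
  set F := ∑' T : PTree3, (t : ℂ) ^ T.edges * T.labelSum x
  have hgraft (e : Fin 3) :
      ∑' p : PTree3 × PTree3, (t : ℂ) ^ (graft e p.1 p.2).edges * (graft e p.1 p.2).labelSum x =
        t * (x ^ ((e : ℤ) - 1) * (F * A) + A * F) := by
    rw [← ((((hasSum_mul_of_summable_norm h1 h).mul_left (x ^ ((e : ℤ) - 1))).add
      (hasSum_mul_of_summable_norm h h1)).mul_left (t : ℂ)).tsum_eq]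
    refine tsum_congr fun p => ?_
    rw [edges_graft, labelSum_graft]
    ring
  refine (tsum_eq_add_sum_graft h1.of_norm).trans ?_
  rw [Finset.sum_congr rfl fun e _ => hgraft e,
    sum_zpow_sub_one x fun z => t * (z * (F * A) + A * F)]
  simp
  ring

/-- The two-point series `F₂` at inverse arguments. -/
lemma tsum_labelSum_mul_eq (ht0 : 0 ≤ t) (ht : t < 1 / 12) (hx : ‖x‖ = 1) :
    ∑' T : PTree3, (t : ℂ) ^ T.edges * T.labelSum x * T.labelSum x⁻¹ =
      1 + 6 * t * (∑' T : PTree3, (t : ℂ) ^ T.edges) *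
        (∑' T : PTree3, (t : ℂ) ^ T.edges * T.labelSum x * T.labelSum x⁻¹) +
      2 * t * (x⁻¹ + 1 + x) * (∑' T : PTree3, (t : ℂ) ^ T.edges * T.labelSum x) *
        ∑' T : PTree3, (t : ℂ) ^ T.edges * T.labelSum x⁻¹ := by
  have hx0 : x ≠ 0 := by rintro rfl; simp at hx
  have hx' : ‖x⁻¹‖ = 1 := by rw [norm_inv, hx, inv_one]
  have h := summable_norm_pow ht0 ht
  have h1 := summable_norm_labelSum ht0 ht hx
  have h1' := summable_norm_labelSum ht0 ht hx'
  have h2 := summable_norm_labelSum_mul ht0 ht hx hx'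
  set A := ∑' T : PTree3, (t : ℂ) ^ T.edges
  set F := ∑' T : PTree3, (t : ℂ) ^ T.edges * T.labelSum x
  set F' := ∑' T : PTree3, (t : ℂ) ^ T.edges * T.labelSum x⁻¹
  set G := ∑' T : PTree3, (t : ℂ) ^ T.edges * T.labelSum x * T.labelSum x⁻¹
  have hgraft (e : Fin 3) :
      ∑' p : PTree3 × PTree3, (t : ℂ) ^ (graft e p.1 p.2).edges *
          (graft e p.1 p.2).labelSum x * (graft e p.1 p.2).labelSum x⁻¹ =
        t * (G * A + x ^ ((e : ℤ) - 1) * (F * F') +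
          ((x ^ ((e : ℤ) - 1))⁻¹ * (F' * F) + A * G)) := by
    rw [← ((((hasSum_mul_of_summable_norm h2 h).add
        ((hasSum_mul_of_summable_norm h1 h1').mul_left (x ^ ((e : ℤ) - 1)))).add
      (((hasSum_mul_of_summable_norm h1' h1).mul_left (x ^ ((e : ℤ) - 1))⁻¹).add
        (hasSum_mul_of_summable_norm h h2))).mul_left (t : ℂ)).tsum_eq]
    refine tsum_congr fun p => ?_
    rw [edges_graft, labelSum_graft, labelSum_graft, inv_zpow]
    have hz : x ^ ((e : ℤ) - 1) ≠ 0 := zpow_ne_zero _ hx0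
    field_simp
    ring
  refine (tsum_eq_add_sum_graft h2.of_norm).trans ?_
  rw [Finset.sum_congr rfl fun e _ => hgraft e,
    sum_zpow_sub_one x fun z => t * (G * A + z * (F * F') + (z⁻¹ * (F' * F) + A * G))]
  simp
  ring

end Series

end PTree3

lemma Tfun3_eq {t : ℝ} (ht0 : 0 < t) (ht : t < 1 / 12) :
    Tfun3 t = 3 * t * (1 + Tfun3 t) ^ 2 := by
  have hs := Real.sq_sqrt (show 0 ≤ 1 - 12 * t by linarith)
  unfold Tfun3
  generalize √(1 - 12 * t) = r at hs ⊢
  field_simp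
  linear_combination (-3) * hs

lemma Tfun3_nonneg {t : ℝ} (ht0 : 0 < t) (ht : t < 1 / 12) : 0 ≤ Tfun3 t := by
  rw [Tfun3_eq ht0 ht]
  positivity

lemma Tfun3_lt_one {t : ℝ} (ht0 : 0 < t) (ht : t < 1 / 12) : Tfun3 t < 1 := by
  rw [Tfun3, div_lt_one (by positivity)]
  have : 1 - 12 * t < √(1 - 12 * t) :=
    Real.lt_sqrt_of_sq_lt (by nlinarith)
  linarith

lemma PTree3.tsum_pow_edges_eq_one_add_Tfun3 {t : ℝ} (ht0 : 0 < t) (ht : t < 1 / 12) :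
    ∑' T : PTree3, (t : ℂ) ^ T.edges = 1 + (Tfun3 t : ℂ) := by
  have h := tsum_pow_edges_eq ht0.le ht
  have h2 := tsum_pow_edges_real_le_two ht0.le ht.le
  have hcast : ∑' T : PTree3, (t : ℂ) ^ T.edges = ((∑' T : PTree3, t ^ T.edges : ℝ) : ℂ) := by
    push_cast; rfl
  rw [hcast] at h ⊢
  set A := ∑' T : PTree3, t ^ T.edges
  have hA : A = 1 + 3 * t * A ^ 2 := by exact_mod_cast h
  have hT := Tfun3_eq ht0 ht
  have hT1 := Tfun3_lt_one ht0 ht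
  have hfac : (A - (1 + Tfun3 t)) * (1 - 3 * t * (A + 1 + Tfun3 t)) = 0 := by
    linear_combination hA - hT
  have hne : 1 - 3 * t * (A + 1 + Tfun3 t) ≠ 0 := by nlinarith
  have := (mul_eq_zero.1 hfac).resolve_right hne
  exact_mod_cast sub_eq_zero.1 this

/-- For plane trees with edge increments in `{0, ±1}`:
`F₂(t, e^{iu}, e^{-iu}) = (1+T)(9 + T²(1+2cos u)²)/((1-T)(3 - T(1+2cos u))²)`
with `T = 3t(1+T)²`. -/
theorem F2_plane_pm01_specialization (t u : ℝ) (ht0 : 0 < t) (ht : t < 1/12) :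
    (Tfun3 t : ℂ) = 3*t*(1 + (Tfun3 t : ℂ))^2 ∧
    (∑' T : PTree3, (t : ℂ)^T.edges
        * T.labelSum (Complex.exp (Complex.I * u))
        * T.labelSum (Complex.exp (-Complex.I * u)))
      = (1 + (Tfun3 t : ℂ)) * (9 + (Tfun3 t : ℂ)^2 * (1 + 2*(Real.cos u : ℂ))^2) /
        ((1 - (Tfun3 t : ℂ)) * (3 - (Tfun3 t : ℂ) * (1 + 2*(Real.cos u : ℂ)))^2) := by
  have hTr := Tfun3_eq ht0 ht
  have hT0 := Tfun3_nonneg ht0 ht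
  have hT1 := Tfun3_lt_one ht0 ht
  have hT : (Tfun3 t : ℂ) = 3 * t * (1 + (Tfun3 t : ℂ)) ^ 2 := by exact_mod_cast hTr
  refine ⟨hT, ?_⟩
  set x := Complex.exp (Complex.I * u) with hx
  have hy : Complex.exp (-Complex.I * u) = x⁻¹ := by rw [hx, ← Complex.exp_neg, neg_mul]
  have hxn : ‖x‖ = 1 := by rw [hx, mul_comm, Complex.norm_exp_ofReal_mul_I]
  have hxn' : ‖x⁻¹‖ = 1 := by rw [norm_inv, hxn, inv_one]
  have hp : x⁻¹ + 1 + x = 1 + 2 * (Real.cos u : ℂ) := by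
    rw [← hy, Complex.ofReal_cos, Complex.two_cos, hx, mul_comm Complex.I, neg_mul, neg_mul,
      mul_comm Complex.I]
    ring
  have hF := PTree3.tsum_labelSum_eq ht0.le ht hxn
  have hF' := PTree3.tsum_labelSum_eq ht0.le ht hxn'
  have hG := PTree3.tsum_labelSum_mul_eq ht0.le ht hxn
  rw [inv_inv, show x + 1 + x⁻¹ = x⁻¹ + 1 + x by ring] at hF'
  rw [PTree3.tsum_pow_edges_eq_one_add_Tfun3 ht0 ht, hp] at hF hF' hG
  rw [hy]
  set F := ∑' T : PTree3, (t : ℂ) ^ T.edges * T.labelSum x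
  set F' := ∑' T : PTree3, (t : ℂ) ^ T.edges * T.labelSum x⁻¹
  set G := ∑' T : PTree3, (t : ℂ) ^ T.edges * T.labelSum x * T.labelSum x⁻¹
  have hd1 : (1 : ℂ) - Tfun3 t ≠ 0 := by
    exact_mod_cast (sub_pos.2 hT1).ne'
  have hd2 : (3 : ℂ) - Tfun3 t * (1 + 2 * (Real.cos u : ℂ)) ≠ 0 := by
    have : 0 < 3 - Tfun3 t * (1 + 2 * Real.cos u) := by nlinarith [Real.cos_le_one u]
    exact_mod_cast this.ne'
  have hd3 : (1 : ℂ) + Tfun3 t ≠ 0 := by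
    exact_mod_cast (by linarith : 0 < 1 + Tfun3 t).ne'
  generalize (1 : ℂ) + 2 * (Real.cos u : ℂ) = p at *
  generalize (Tfun3 t : ℂ) = T at *
  have ht' : (t : ℂ) = T / (3 * (1 + T) ^ 2) := by
    rw [eq_div_iff (by simpa using hd3)]
    linear_combination -hT
  have hone {f : ℂ} (hf : f = 1 + t * (3 + p) * (1 + T) * f) :
      f = 3 * (1 + T) / (3 - T * p) := by
    rw [ht'] at hf
    field_simp at hf
    rw [eq_div_iff hd2]
    linear_combination hf
  rw [hone hF, hone hF', ht'] at hG
  field_simp at hG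
  rw [eq_div_iff (by positivity)]
  linear_combination hG / 3
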